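/- arXiv:1311.0522 — 2 statements merged into one kernel-verified Lean document; each statement's English description precedes it below -/
import Mathlib

section
/- A finite simple cubic graph G has a directed cycle double cover if and only if its hexagon graph H admits a safe blue perfect matching. -/
open SimpleGraph

namespace Hex

variable {V : Type}

/-- A graph is cubic (3-regular) if every vertex has exactly 3 neighbors. -/
def IsCubic (G : SimpleGraph V) : Prop := ∀ v : V, (G.neighborSet v).ncard = 3

/-- A graph is bridgeless if none of its edges is a bridge. -/
def Bridgeless (G : SimpleGraph V) : Prop := ∀ e ∈ G.edgeSet, ¬G.IsBridge e

/-- A valid assignment of the indices `i_{v(u)} ∈ {0,1,2}`: with each neighbor `u` of `v`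
an index in `{0,1,2}` is associated, pairwise distinct for distinct neighbors. -/
def GoodIdx (G : SimpleGraph V) (idx : V → V → ZMod 6) : Prop :=
  (∀ v u : V, G.Adj v u → (idx v u).val < 3) ∧
  (∀ v u w : V, G.Adj v u → G.Adj v w → u ≠ w → idx v u ≠ idx v w)

/-- The pair of white edges `(e_{uv}, e'_{uv})` replacing the edge `uv` of `G`.
A vertex `v_i` belongs to the class `X` iff `i` is even, to `Y` iff `i` is odd. -/
def whitePairs (idx : V → V → ZMod 6) (u v : V) :
    Sym2 (V × ZMod 6) × Sym2 (V × ZMod 6) :=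
  if (idx u v).val % 2 = (idx v u).val % 2 then
    (s((u, idx u v), (v, idx v u + 3)), s((u, idx u v + 3), (v, idx v u)))
  else
    (s((u, idx u v), (v, idx v u)), s((u, idx u v + 3), (v, idx v u + 3)))

/-- The white edges of the hexagon graph. -/
def IsWhite (G : SimpleGraph V) (idx : V → V → ZMod 6) (e : Sym2 (V × ZMod 6)) : Prop :=
  ∃ u v : V, G.Adj u v ∧ (e = (whitePairs idx u v).1 ∨ e = (whitePairs idx u v).2)

/-- The red edges of the hexagon graph: the edges `v_i v_{i+3}`. -/
def IsRed (e : Sym2 (V × ZMod 6)) : Prop :=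
  ∃ (v : V) (i : ZMod 6), e = s((v, i), (v, i + 3))

/-- The blue edges of the hexagon graph: the edges `v_i v_{i+1}`. -/
def IsBlue (e : Sym2 (V × ZMod 6)) : Prop :=
  ∃ (v : V) (i : ZMod 6), e = s((v, i), (v, i + 1))

/-- The hexagon graph of `G` with respect to an index assignment `idx`: each vertex `v` of `G`
is replaced by a hexagon (a copy of `K_{3,3}` with vertex set `{v} × ZMod 6`, and edge set
`{v_i v_{i+1}} ∪ {v_i v_{i+3}}`), and each edge `uv` of `G` is replaced by the two white
edges `e_{uv}`, `e'_{uv}`. -/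
def hexagonGraph (G : SimpleGraph V) (idx : V → V → ZMod 6) : SimpleGraph (V × ZMod 6) :=
  SimpleGraph.fromRel fun p q =>
    (p.1 = q.1 ∧ (q.2 = p.2 + 1 ∨ q.2 = p.2 + 3)) ∨ IsWhite G idx s(p, q)

/-- A blue perfect matching of the hexagon graph: a perfect matching all of whose edges
are blue. -/
def IsBluePM (G : SimpleGraph V) (idx : V → V → ZMod 6)
    (M : (hexagonGraph G idx).Subgraph) : Prop :=
  M.IsPerfectMatching ∧ ∀ e ∈ M.edgeSet, IsBlue e

/-- The graph `M Δ W` on the vertices of the hexagon graph, whose edge set is the symmetric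
difference of the edge set of `M` and the set `W` of white edges. Its connected components
are the cycles of `M Δ W`. -/
def sdGraph (G : SimpleGraph V) (idx : V → V → ZMod 6)
    (M : (hexagonGraph G idx).Subgraph) : SimpleGraph (V × ZMod 6) :=
  SimpleGraph.fromEdgeSet (symmDiff M.edgeSet {e | IsWhite G idx e})

/-- The edge set of the subgraph of `G` induced by the cycle (connected component) `c`
of `M Δ W`: the edges `uv` of `G` such that `e_{uv}` or `e'_{uv}` belongs to `c`. -/
def inducedSet (G : SimpleGraph V) (idx : V → V → ZMod 6)
    (M : (hexagonGraph G idx).Subgraph)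
    (c : (sdGraph G idx M).ConnectedComponent) : Set (Sym2 V) :=
  {e | ∃ (u v : V) (i j : ZMod 6), (sdGraph G idx M).Adj (u, i) (v, j) ∧ u ≠ v ∧
    (sdGraph G idx M).connectedComponentMk (u, i) = c ∧ e = s(u, v)}

/-- A rotation system of `G`: for each vertex `v`, a cyclic permutation of the edges
incident with `v` (encoded on darts with tail `v`). -/
structure RotationSystem (G : SimpleGraph V) where
  σ : G.Dart ≃ G.Dart
  tail_eq : ∀ d : G.Dart, (σ d).toProd.1 = d.toProd.1
  cyclic : ∀ d d' : G.Dart, d.toProd.1 = d'.toProd.1 → ∃ n : ℕ, (⇑σ)^[n] d = d'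

/-- The face-traversal map of a rotation system: after traversing the dart `d = (v, w)`,
the next dart is obtained by applying the rotation at `w` to the edge of `d`. -/
def facePerm {G : SimpleGraph V} (ρ : RotationSystem G) : G.Dart → G.Dart :=
  fun d => ρ.σ d.symm

/-- The face boundaries of a rotation system, as edge sets of `G`. -/
def faceSets {G : SimpleGraph V} (ρ : RotationSystem G) : Set (Set (Sym2 V)) :=
  {S | ∃ d : G.Dart, S = {e | ∃ n : ℕ, ((facePerm ρ)^[n] d).edge = e}}

/-- The cyclic shift `0 ↦ 1 ↦ 2 ↦ 0` on the index set `{0,1,2} ⊂ ZMod 6`. -/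
def rot3 (a : ZMod 6) : ZMod 6 := if a = 2 then 0 else a + 1

/-- The cyclic shift `0 ↦ 2 ↦ 1 ↦ 0` on the index set `{0,1,2} ⊂ ZMod 6`. -/
def rot3inv (a : ZMod 6) : ZMod 6 := if a = 0 then 2 else a - 1

/-- An edge `e` belongs to the cycle (connected component) `c` of a graph `K`. -/
def edgeInComp {W : Type} (K : SimpleGraph W) (e : Sym2 W) (c : K.ConnectedComponent) :
    Prop :=
  e ∈ K.edgeSet ∧ ∀ x ∈ e, K.connectedComponentMk x = c

/-- A blue perfect matching `M` is safe if no cycle of `M Δ W` contains both end vertices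
of a red edge, i.e. no component of `M Δ W` contains both `(v, i)` and `(v, i + 3)`. -/
def SafePM (G : SimpleGraph V) (idx : V → V → ZMod 6)
    (M : (hexagonGraph G idx).Subgraph) : Prop :=
  ∀ (v : V) (i : ZMod 6), ¬(sdGraph G idx M).Reachable (v, i) (v, i + 3)

/-- A directed cycle double cover of `G`: a family of directed cycles (cycles traversed
in a chosen direction) such that every dart of `G` is traversed by exactly one member;
equivalently, every edge lies on exactly two members and they induce opposite
orientations on it. -/
def HasDCDC (G : SimpleGraph V) : Prop :=
  ∃ (ι : Type) (F : ι → Σ v : V, G.Walk v v),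
    (∀ i, (F i).2.IsCycle) ∧ ∀ d : G.Dart, ∃! i, d ∈ (F i).2.darts

/-- A brace: a simple connected bipartite graph on at least six vertices that has a
perfect matching and such that every pair of vertex-disjoint edges is contained in a
perfect matching. -/
def IsBrace {W : Type} [Fintype W] (H : SimpleGraph W) : Prop :=
  H.Connected ∧ H.Colorable 2 ∧ 6 ≤ Fintype.card W ∧
  (∃ M : H.Subgraph, M.IsPerfectMatching) ∧
  ∀ e₁ ∈ H.edgeSet, ∀ e₂ ∈ H.edgeSet, (∀ x ∈ e₁, x ∉ e₂) →
    ∃ M : H.Subgraph, M.IsPerfectMatching ∧ e₁ ∈ M.edgeSet ∧ e₂ ∈ M.edgeSet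

/-- The ladder `L_{2n}`: vertices `a_0, …, a_{n-1}, b_0, …, b_{n-1}`, with edges
`a_i a_{i+1}`, `b_i b_{i+1}` (indices mod `n`) and the rungs `a_i b_i`.
In particular `ladder 4` is the ladder `L_8` on 8 vertices. -/
def ladder (n : ℕ) : SimpleGraph (Fin 2 × ZMod n) :=
  SimpleGraph.fromRel fun p q => (p.1 = q.1 ∧ q.2 = p.2 + 1) ∨ (p.1 ≠ q.1 ∧ p.2 = q.2)

/-- The expansion of a vertex `x` to a path `x¹ v x²`, relative to the part `N1` of a
partition `(N1, N(x) \ N1)` of the neighborhood of `x`: `x` is deleted, the new path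
`x¹ v x²` is added (here `v := Sum.inl x`, `x¹ := Sum.inr 0`, `x² := Sum.inr 1`), every
vertex of `N1` is joined to `x¹` and every other neighbor of `x` is joined to `x²`. -/
def expansion {α : Type} (H : SimpleGraph α) (x : α) (N1 : Set α) :
    SimpleGraph (α ⊕ Fin 2) :=
  SimpleGraph.fromRel fun p q =>
    match p, q with
    | Sum.inl a, Sum.inl b => H.Adj a b ∧ a ≠ x ∧ b ≠ x
    | Sum.inr i, Sum.inl a =>
        (a = x ∧ (i = 0 ∨ i = 1)) ∨ (i = 0 ∧ a ∈ N1 ∧ H.Adj x a) ∨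
        (i = 1 ∧ a ∉ N1 ∧ H.Adj x a)
    | _, _ => False

/-- `H'` is obtained from `H` by a type-1 augmentation: one new edge is added so that the
result is bipartite (stated up to isomorphism). -/
def IsType1Aug {α β : Type} (H : SimpleGraph α) (H' : SimpleGraph β) : Prop :=
  ∃ x y : α, x ≠ y ∧ ¬H.Adj x y ∧
    (SimpleGraph.fromEdgeSet (insert s(x, y) H.edgeSet)).Colorable 2 ∧
    Nonempty (H' ≃g SimpleGraph.fromEdgeSet (insert s(x, y) H.edgeSet))

/-- `H'` is obtained from `H` by a type-2 augmentation: a vertex `x` of degree at least 4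
is expanded to `x¹ v x²` (with both parts of the neighborhood partition of size at least 2)
and a new edge `v w` is added, where `w` is a vertex in the same partition class as `x`
(stated up to isomorphism). -/
def IsType2Aug {α β : Type} (H : SimpleGraph α) (H' : SimpleGraph β) : Prop :=
  ∃ (x w : α) (N1 : Set α),
    4 ≤ (H.neighborSet x).ncard ∧ N1 ⊆ H.neighborSet x ∧ 2 ≤ N1.ncard ∧
    2 ≤ (H.neighborSet x \ N1).ncard ∧ w ≠ x ∧
    (∃ C : H.Coloring (Fin 2), C w = C x) ∧
    Nonempty (H' ≃g SimpleGraph.fromEdgeSet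
      (insert s(Sum.inl x, Sum.inl w) (expansion H x N1).edgeSet))

/-- A bundled graph (a graph together with its vertex type). -/
structure BundledGraph : Type 1 where
  carrier : Type
  graph : SimpleGraph carrier

/-- A simple augmentation: a type-1 or a type-2 augmentation. -/
def IsSimpleAug (A B : BundledGraph) : Prop :=
  IsType1Aug A.graph B.graph ∨ IsType2Aug A.graph B.graph

/-- The set of vertices of the square `s_v` that are covered by an edge of `S`
(for `S` the projection of an edge or path, these are the vertices of its
supporting edge in `s_v`). -/
def sqSupp (v : V) (S : Set (Sym2 (V × ZMod 4))) : Set (V × ZMod 4) :=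
  {p | p.1 = v ∧ ∃ e ∈ S, p ∈ e}

/-- An `M`-square graph of `G`: each vertex `v` of `G` is replaced by a square `s_v`
(a copy of `K_{2,2}` on `{v} × ZMod 4`, with edge set `{v_j v_{j+1}}`), and each edge `uv`
of `G` is replaced by its projection `pr u v`, a set of two edges forming, together with a
supporting edge in each of `s_u`, `s_v`, a copy of `K_{2,2}`; whenever `uv ∈ M` and `w, z`
are the other two neighbors of `v`, the supporting edges of `pr w v` and `pr z v` in `s_v`
are vertex-disjoint. -/
structure SquareGraph (G : SimpleGraph V) (M : Set (Sym2 V)) where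
  Q : SimpleGraph (V × ZMod 4)
  pr : V → V → Set (Sym2 (V × ZMod 4))
  bip : Q.Colorable 2
  intra : ∀ (v : V) (j k : ZMod 4), Q.Adj (v, j) (v, k) ↔ (k = j + 1 ∨ j = k + 1)
  pr_symm : ∀ u v : V, pr u v = pr v u
  pr_shape : ∀ u v : V, G.Adj u v → ∃ j k : ZMod 4,
    pr u v = {s((u, j), (v, k)), s((u, j + 1), (v, k + 1))} ∨
    pr u v = {s((u, j), (v, k)), s((u, j + 1), (v, k + 3))}
  inter : ∀ (u v : V) (j k : ZMod 4), u ≠ v →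
    (Q.Adj (u, j) (v, k) ↔ G.Adj u v ∧ s((u, j), (v, k)) ∈ pr u v)
  matched : ∀ v u w z : V, G.Adj v u → G.Adj v w → G.Adj v z → u ≠ w → u ≠ z → w ≠ z →
    s(u, v) ∈ M → Disjoint (sqSupp v (pr w v)) (sqSupp v (pr z v))

/-- An odd ear decomposition of `G`: a sequence of subgraphs `G_0, …, G_l` where `G_0` is
an even cycle, `G_l = G`, and each `G_i` is obtained from `G_{i-1}` by attaching an odd
path (ear) whose ends lie in `G_{i-1}` and which is otherwise disjoint from `G_{i-1}`. -/
structure OddEarDecomp (G : SimpleGraph V) where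
  l : ℕ
  Gs : Fin (l + 1) → G.Subgraph
  base : ∃ (v : V) (c : G.Walk v v), c.IsCycle ∧ Even c.length ∧ Gs 0 = c.toSubgraph
  top : Gs (Fin.last l) = ⊤
  ear : ∀ i : Fin l, ∃ (a b : V) (p : G.Walk a b),
    p.IsPath ∧ Odd p.length ∧
    a ∈ (Gs i.castSucc).verts ∧ b ∈ (Gs i.castSucc).verts ∧
    (∀ w ∈ p.support, w ≠ a → w ≠ b → w ∉ (Gs i.castSucc).verts) ∧
    (∀ e ∈ p.edges, e ∉ (Gs i.castSucc).edgeSet) ∧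
    Gs i.succ = Gs i.castSucc ⊔ p.toSubgraph

/-- A perfect matching `M` of `G` is absolute in an odd ear decomposition if its
restriction to each `G_i` is a perfect matching of `G_i`. -/
def AbsoluteIn {G : SimpleGraph V} (M : G.Subgraph) (D : OddEarDecomp G) : Prop :=
  ∀ i : Fin (D.l + 1), ∀ v ∈ (D.Gs i).verts, ∃! w : V, M.Adj v w ∧ (D.Gs i).Adj v w

/-- The set `V_3(K)` of vertices of degree 3 in the subgraph `K`. -/
def deg3 {G : SimpleGraph V} (K : G.Subgraph) : Set V :=
  {v | (K.neighborSet v).ncard = 3}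

/-- A member of `P(K)`: a path of `K` whose end vertices have degree 3 in `K` and all of
whose internal vertices have degree 2 in `K`. -/
def IsEarPath {G : SimpleGraph V} (K : G.Subgraph) {u v : V} (p : G.Walk u v) : Prop :=
  p.IsPath ∧ 0 < p.length ∧ (∀ e ∈ p.edges, e ∈ K.edgeSet) ∧
  u ∈ deg3 K ∧ v ∈ deg3 K ∧
  ∀ w ∈ p.support, w ≠ u → w ≠ v → (K.neighborSet w).ncard = 2

/-- A `(K, M)`-ear square graph (for `K` one of the graphs `G_i` of an ear decomposition):
each vertex `v` of degree 3 in `K` is replaced by a square `s_v` on `{v} × ZMod 4` (all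
other vertices of the ambient type are isolated), and each path `p(u,v) ∈ P(K)` is
replaced by its projected path `pr p`, a set of two edges forming, together with a
supporting edge in each of `s_u`, `s_v`, a copy of `K_{2,2}`; projected paths of distinct
paths are disjoint; and for every `v ∈ V_3(K)`, the two paths at `v` other than the
matching-path of `v` have vertex-disjoint supporting edges in `s_v`. -/
structure EarSquareGraph (G : SimpleGraph V) (K : G.Subgraph) (M : Set (Sym2 V)) where
  Q : SimpleGraph (V × ZMod 4)
  pr : ∀ {u v : V}, G.Walk u v → Set (Sym2 (V × ZMod 4))
  bip : Q.Colorable 2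
  isolated : ∀ (v : V) (j : ZMod 4) (q : V × ZMod 4), v ∉ deg3 K → ¬Q.Adj (v, j) q
  intra : ∀ v ∈ deg3 K, ∀ j k : ZMod 4, Q.Adj (v, j) (v, k) ↔ (k = j + 1 ∨ j = k + 1)
  pr_symm : ∀ {u v : V} (p : G.Walk u v), pr p.reverse = pr p
  pr_shape : ∀ {u v : V} (p : G.Walk u v), IsEarPath K p → ∃ j k : ZMod 4,
    pr p = {s((u, j), (v, k)), s((u, j + 1), (v, k + 1))} ∨
    pr p = {s((u, j), (v, k)), s((u, j + 1), (v, k + 3))}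
  pr_disjoint : ∀ {u v u' v' : V} (p : G.Walk u v) (q : G.Walk u' v'),
    IsEarPath K p → IsEarPath K q →
    (⟨u, v, p⟩ : Σ a b : V, G.Walk a b) ≠ ⟨u', v', q⟩ →
    (⟨u, v, p⟩ : Σ a b : V, G.Walk a b) ≠ ⟨v', u', q.reverse⟩ →
    Disjoint (pr p) (pr q)
  inter : ∀ (u v : V) (j k : ZMod 4), u ≠ v →
    (Q.Adj (u, j) (v, k) ↔ ∃ p : G.Walk u v, IsEarPath K p ∧ s((u, j), (v, k)) ∈ pr p)
  matched : ∀ (v y z : V) (q : G.Walk v y) (r : G.Walk v z),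
    IsEarPath K q → IsEarPath K r → q.getVert 1 ≠ r.getVert 1 →
    (∀ w : V, s(v, w) ∈ M → q.getVert 1 ≠ w ∧ r.getVert 1 ≠ w) →
    Disjoint (sqSupp v (pr q)) (sqSupp v (pr r))

/-- A successor permutation on darts: each dart is followed by a dart starting at its head, and
no orbit contains both a dart and its reverse. -/
def IsOneWayTraversal (G : SimpleGraph V) (φ : Equiv.Perm G.Dart) : Prop :=
  (∀ d, (φ d).fst = d.snd) ∧ ∀ d, ¬ φ.SameCycle d d.symm

theorem eq_of_sameCycle {α β : Type*} {φ : Equiv.Perm α} {f : α → β} (h : ∀ x, f (φ x) = f x)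
    {x y : α} (hxy : φ.SameCycle x y) : f x = f y := by
  obtain ⟨n, rfl⟩ := hxy
  induction n with
  | zero => simp
  | succ n ih =>
    rw [add_comm, zpow_add, zpow_one, Equiv.Perm.mul_apply, h]
    exact ih
  | pred n ih =>
    rw [ih, ← h ((φ ^ (-(n : ℤ) - 1)) x), ← Equiv.Perm.mul_apply, ← zpow_one_add]
    congr 3
    ring

section Walks

variable {G : SimpleGraph V}

/-- The walk traversing the darts `d, φ d, …, φ^[n-1] d`. -/
def orbitWalk (φ : Equiv.Perm G.Dart) (hφ : ∀ d, (φ d).fst = d.snd) :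
    (n : ℕ) → (d : G.Dart) → G.Walk d.fst (φ^[n] d).fst
  | 0, _ => .nil
  | n + 1, d => Walk.cons (v := d.snd) d.adj ((orbitWalk φ hφ n (φ d)).copy (hφ d) rfl)

theorem darts_orbitWalk (φ : Equiv.Perm G.Dart) (hφ : ∀ d, (φ d).fst = d.snd) (n : ℕ)
    (d : G.Dart) : (orbitWalk φ hφ n d).darts = List.iterate φ d n := by
  induction n generalizing d with
  | zero => rfl
  | succ n ih =>
    simp [orbitWalk, List.iterate, ih]
    exact Dart.ext _ _ (Prod.ext rfl (hφ d))

theorem minimalPeriod_pos [Finite V] (φ : Equiv.Perm G.Dart) (d : G.Dart) :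
    0 < Function.minimalPeriod φ d := by
  have : Finite G.Dart := Finite.of_injective (fun d => d.toProd) fun _ _ h => Dart.ext _ _ h
  exact Function.minimalPeriod_pos_of_mem_periodicPts (φ.injective.mem_periodicPts d)

/-- The closed walk traversing the `φ`-orbit of `d` once. -/
noncomputable def orbitCycle (φ : Equiv.Perm G.Dart) (hφ : ∀ d, (φ d).fst = d.snd)
    (d : G.Dart) : G.Walk d.fst d.fst :=
  (orbitWalk φ hφ (Function.minimalPeriod φ d) d).copy rfl
    (by rw [Function.iterate_minimalPeriod])

theorem darts_orbitCycle (φ : Equiv.Perm G.Dart) (hφ : ∀ d, (φ d).fst = d.snd) (d : G.Dart) :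
    (orbitCycle φ hφ d).darts = List.iterate φ d (Function.minimalPeriod φ d) := by
  simp [orbitCycle, darts_orbitWalk]

theorem mem_darts_orbitCycle [Finite V] (φ : Equiv.Perm G.Dart)
    (hφ : ∀ d, (φ d).fst = d.snd) (d d' : G.Dart) :
    d' ∈ (orbitCycle φ hφ d).darts ↔ φ.SameCycle d d' := by
  have : Finite G.Dart := Finite.of_injective (fun d => d.toProd) fun _ _ h => Dart.ext _ _ h
  rw [darts_orbitCycle, List.mem_iterate]
  constructor
  · rintro ⟨m, -, rfl⟩
    exact ⟨m, by simp [Equiv.Perm.iterate_eq_pow]⟩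
  · intro h
    obtain ⟨n, rfl⟩ := h.exists_nat_pow_eq
    exact ⟨n % Function.minimalPeriod φ d, Nat.mod_lt _ (minimalPeriod_pos φ d),
      by rw [Function.iterate_mod_minimalPeriod_eq, Equiv.Perm.iterate_eq_pow]⟩

theorem nodup_darts_orbitCycle (φ : Equiv.Perm G.Dart)
    (hφ : ∀ d, (φ d).fst = d.snd) (d : G.Dart) : (orbitCycle φ hφ d).darts.Nodup := by
  rw [darts_orbitCycle, ← List.range_map_iterate]
  refine List.Nodup.map_on (fun a ha b hb h => ?_) List.nodup_range
  exact Function.iterate_injOn_Iio_minimalPeriod (by simpa using ha) (by simpa using hb) h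

theorem IsOneWayTraversal.eq_of_snd_eq (hG : IsCubic G) {φ : Equiv.Perm G.Dart}
    (hφ : IsOneWayTraversal G φ) {d d' : G.Dart} (hd : φ.SameCycle d d') (h : d.snd = d'.snd) :
    d = d' := by
  by_contra hne
  have hfst : d.fst ≠ d'.fst := fun h' => hne (Dart.ext _ _ (Prod.ext h' h))
  have key : ∀ e e' : G.Dart, φ.SameCycle e e' → e.snd = e'.snd → (φ e).snd ≠ e'.fst := by
    intro e e' he hs h'
    refine hφ.2 e' ?_
    have : φ e = e'.symm := Dart.ext _ _ (Prod.ext ((hφ.1 e).trans hs) h')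
    rw [← this, Equiv.Perm.sameCycle_apply_right]
    exact he.symm
  have h1 := key d d .rfl rfl
  have h2 := key d d' hd h
  have h3 := key d' d hd.symm h.symm
  have h4 := key d' d' .rfl rfl
  obtain ⟨a, b, c, -, -, -, hN⟩ := Set.ncard_eq_three.1 (hG d.snd)
  have m1 : d.fst ∈ G.neighborSet d.snd := d.adj.symm
  have m2 : d'.fst ∈ G.neighborSet d.snd := h ▸ d'.adj.symm
  have m3 : (φ d).snd ∈ G.neighborSet d.snd := hφ.1 d ▸ (φ d).adj
  have m4 : (φ d').snd ∈ G.neighborSet d.snd := by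
    rw [h, ← hφ.1 d']
    exact (φ d').adj
  have : (φ d).snd = (φ d').snd := by
    simp only [hN, Set.mem_insert_iff, Set.mem_singleton_iff] at m1 m2 m3 m4
    grind
  exact hne (φ.injective (Dart.ext _ _ (Prod.ext (by
    change (φ d).fst = (φ d').fst
    rw [hφ.1, hφ.1, h]) this)))

theorem IsOneWayTraversal.isCycle_orbitCycle [Finite V] (hG : IsCubic G) {φ : Equiv.Perm G.Dart}
    (hφ : IsOneWayTraversal G φ) (d : G.Dart) : (orbitCycle φ hφ.1 d).IsCycle := by
  have hsame : ∀ x ∈ (orbitCycle φ hφ.1 d).darts, ∀ y ∈ (orbitCycle φ hφ.1 d).darts,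
      φ.SameCycle x y := fun x hx y hy =>
    ((mem_darts_orbitCycle φ hφ.1 d x).1 hx).symm.trans
      ((mem_darts_orbitCycle φ hφ.1 d y).1 hy)
  rw [Walk.isCycle_def]
  refine ⟨⟨?_⟩, ?_, ?_⟩
  · refine List.Nodup.map_on (fun x hx y hy h => ?_) (nodup_darts_orbitCycle φ hφ.1 d)
    rcases (dart_edge_eq_iff x y).1 h with h | h
    · exact h
    · exact absurd (h ▸ hsame y hy x hx) (hφ.2 y)
  · intro h
    have : d ∈ (orbitCycle φ hφ.1 d).darts := (mem_darts_orbitCycle φ hφ.1 d d).2 .rfl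
    simp [h] at this
  · rw [← Walk.map_snd_darts]
    exact List.Nodup.map_on (fun x hx y hy h => hφ.eq_of_snd_eq hG (hsame x hx y hy) h)
      (nodup_darts_orbitCycle φ hφ.1 d)

theorem formPerm_darts_fst [DecidableEq G.Dart] {v : V} (p : G.Walk v v) (hp : p.darts.Nodup)
    {d : G.Dart} (hd : d ∈ p.darts) : (p.darts.formPerm d).fst = d.snd := by
  obtain ⟨i, hi, rfl⟩ := List.getElem_of_mem hd
  rw [List.formPerm_apply_getElem _ hp, Walk.darts_getElem_eq_getVert,
    Walk.darts_getElem_eq_getVert]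
  have hl : i < p.length := by simpa using hi
  rcases (Nat.succ_le_of_lt hl).lt_or_eq with h | h
  · simp [Nat.mod_eq_of_lt h]
  · simp [← Nat.succ_eq_add_one, h]

theorem hasDCDC_iff [Finite V] (hG : IsCubic G) :
    HasDCDC G ↔ ∃ φ, IsOneWayTraversal G φ := by
  classical
  constructor
  · rintro ⟨ι, F, hF, hd⟩
    choose i hi hu using hd
    have hnd : ∀ j, (F j).2.darts.Nodup := fun j =>
      List.Nodup.of_map _ (hF j).edges_nodup
    have hmem : ∀ d, (F (i d)).2.darts.formPerm d ∈ (F (i d)).2.darts := fun d =>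
      List.formPerm_apply_mem_of_mem (hi d)
    have hmem' : ∀ d, (F (i d)).2.darts.formPerm⁻¹ d ∈ (F (i d)).2.darts := fun d =>
      List.mem_of_formPerm_apply_mem (by simpa using hi d)
    have hi1 : ∀ d, i ((F (i d)).2.darts.formPerm d) = i d := fun d =>
      (hu _ _ (hmem d)).symm
    have hi2 : ∀ d, i ((F (i d)).2.darts.formPerm⁻¹ d) = i d := fun d =>
      (hu _ _ (hmem' d)).symm
    let φ : Equiv.Perm G.Dart :=
      { toFun := fun d => (F (i d)).2.darts.formPerm d
        invFun := fun d => (F (i d)).2.darts.formPerm⁻¹ d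
        left_inv := fun d => by dsimp only; rw [hi1]; simp
        right_inv := fun d => by dsimp only; rw [hi2]; simp }
    refine ⟨φ, fun d => formPerm_darts_fst _ (hnd _) (hi d), fun d hs => ?_⟩
    have h1 : i d = i d.symm := eq_of_sameCycle hi1 hs
    exact d.symm_ne (List.inj_on_of_nodup_map (hF (i d)).edges_nodup (h1 ▸ hi d.symm) (hi d)
      d.edge_symm)
  · rintro ⟨φ, hφ⟩
    refine ⟨Quotient (Equiv.Perm.SameCycle.setoid φ), fun q => ⟨_, orbitCycle φ hφ.1 q.out⟩,
      fun q => hφ.isCycle_orbitCycle hG q.out, fun d => ⟨⟦d⟧, ?_, fun q hq => ?_⟩⟩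
    · exact (mem_darts_orbitCycle φ hφ.1 _ d).2
        (Quotient.exact (Quotient.out_eq (Quotient.mk (Equiv.Perm.SameCycle.setoid φ) d)))
    · rw [← Quotient.out_eq q]
      exact Quotient.sound ((mem_darts_orbitCycle φ hφ.1 _ d).1 hq)

end Walks

/-- The even representative of `{a, a + 3}` in `ZMod 6`. -/
def evenRep (a : ZMod 6) : ZMod 6 := if a.val % 2 = 0 then a else a + 3

theorem evenRep_inj : ∀ a b : ZMod 6, a.val < 3 → b.val < 3 → evenRep a = evenRep b → a = b := by
  decide

theorem evenRep_ne_add_three : ∀ a b : ZMod 6, evenRep a ≠ evenRep b + 3 := by decide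

theorem evenRep_add_three_add_one_ne : ∀ a b : ZMod 6, evenRep a + 3 + 1 ≠ evenRep b + 3 := by
  decide

theorem evenRep_consecutive : ∀ a b : ZMod 6, a.val < 3 → b.val < 3 → a ≠ b →
    evenRep b = evenRep a + 3 + 1 ∨ evenRep a + 3 = evenRep b + 1 := by decide

theorem exists_evenRep : ∀ i : ZMod 6, ∃ a : ZMod 6, a.val < 3 ∧
    (i = evenRep a ∨ i = evenRep a + 3) := by decide

theorem add_three_add_three : ∀ i : ZMod 6, i + 3 + 3 = i := by decide

theorem ne_add_one : ∀ i : ZMod 6, i ≠ i + 1 := by decide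

section Hexagons

variable {G : SimpleGraph V} {idx : V → V → ZMod 6}

/-- The vertex of the hexagon graph in class `X` at the tail of a dart. -/
def outVert (idx : V → V → ZMod 6) (d : G.Dart) : V × ZMod 6 :=
  (d.fst, evenRep (idx d.fst d.snd))

/-- The vertex of the hexagon graph in class `Y` at the head of a dart. -/
def inVert (idx : V → V → ZMod 6) (d : G.Dart) : V × ZMod 6 :=
  (d.snd, evenRep (idx d.snd d.fst) + 3)

theorem GoodIdx.eq_of_idx_eq (hidx : GoodIdx G idx) {v u w : V} (hu : G.Adj v u)
    (hw : G.Adj v w) (h : idx v u = idx v w) : u = w := by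
  by_contra hne
  exact hidx.2 v u w hu hw hne h

theorem outVert_injective (hidx : GoodIdx G idx) :
    Function.Injective (outVert (G := G) idx) := by
  rintro ⟨⟨u, v⟩, h⟩ ⟨⟨u', v'⟩, h'⟩ he
  simp only [outVert, Prod.mk.injEq] at he
  obtain ⟨rfl, he⟩ := he
  have := hidx.eq_of_idx_eq h h' (evenRep_inj _ _ (hidx.1 _ _ h) (hidx.1 _ _ h') he)
  subst this
  rfl

theorem inVert_injective (hidx : GoodIdx G idx) :
    Function.Injective (inVert (G := G) idx) := by
  intro d d' he
  have : outVert idx d.symm = outVert idx d'.symm := by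
    simp only [inVert, Prod.mk.injEq, add_left_inj] at he
    exact Prod.ext he.1 he.2
  exact Dart.symm_involutive.injective (outVert_injective hidx this)

theorem outVert_ne_inVert (d d' : G.Dart) : outVert idx d ≠ inVert idx d' := fun h =>
  evenRep_ne_add_three _ _ (congrArg Prod.snd h)

theorem GoodIdx.exists_idx_eq (hG : IsCubic G) (hidx : GoodIdx G idx) (v : V) {a : ZMod 6}
    (ha : a.val < 3) : ∃ u, G.Adj v u ∧ idx v u = a := by
  have hsub : idx v '' G.neighborSet v ⊆ ({0, 1, 2} : Finset (ZMod 6)) := by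
    rintro _ ⟨u, hu, rfl⟩
    have : ∀ b : ZMod 6, b.val < 3 → b ∈ ({0, 1, 2} : Finset (ZMod 6)) := by decide
    exact this _ (hidx.1 v u hu)
  have hcard : (idx v '' G.neighborSet v).ncard = 3 := by
    have hinj : Set.InjOn (idx v) (G.neighborSet v) := fun u hu w hw h =>
      hidx.eq_of_idx_eq hu hw h
    exact hinj.ncard_image.trans (hG v)
  have heq := Set.eq_of_subset_of_ncard_le hsub
    (by rw [hcard, Set.ncard_coe_finset]; decide) (Finset.finite_toSet _)
  have : ∀ b : ZMod 6, b.val < 3 → b ∈ ({0, 1, 2} : Finset (ZMod 6)) := by decide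
  have hmem : a ∈ idx v '' G.neighborSet v := heq ▸ Finset.mem_coe.2 (this a ha)
  exact hmem

theorem exists_dart_eq (hG : IsCubic G) (hidx : GoodIdx G idx) (x : V × ZMod 6) :
    ∃ d : G.Dart, x = outVert idx d ∨ x = inVert idx d := by
  obtain ⟨v, i⟩ := x
  obtain ⟨a, ha, hi⟩ := exists_evenRep i
  obtain ⟨u, hu, rfl⟩ := hidx.exists_idx_eq hG v ha
  rcases hi with rfl | rfl
  · exact ⟨⟨(v, u), hu⟩, .inl rfl⟩
  · exact ⟨⟨(u, v), hu.symm⟩, .inr rfl⟩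

theorem isWhite_iff {e : Sym2 (V × ZMod 6)} :
    IsWhite G idx e ↔ ∃ d : G.Dart, e = s(outVert idx d, inVert idx d) := by
  have key : ∀ u v : V, ({(whitePairs idx u v).1, (whitePairs idx u v).2} : Set _) =
      {s((u, evenRep (idx u v)), (v, evenRep (idx v u) + 3)),
        s((v, evenRep (idx v u)), (u, evenRep (idx u v) + 3))} := by
    intro u v
    unfold whitePairs evenRep
    rcases Nat.mod_two_eq_zero_or_one (idx u v).val with h1 | h1 <;>
      rcases Nat.mod_two_eq_zero_or_one (idx v u).val with h2 | h2 <;>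
      simp [h1, h2, add_three_add_three, Sym2.eq_swap, Set.pair_comm]
  constructor
  · rintro ⟨u, v, h, he⟩
    have he' : e ∈ ({(whitePairs idx u v).1, (whitePairs idx u v).2} : Set _) := he
    rw [key] at he'
    rcases he' with he' | he'
    · exact ⟨⟨(u, v), h⟩, he'⟩
    · exact ⟨⟨(v, u), h.symm⟩, he'⟩
  · rintro ⟨⟨⟨u, v⟩, h⟩, rfl⟩
    have : s((u, evenRep (idx u v)), (v, evenRep (idx v u) + 3)) ∈
        ({(whitePairs idx u v).1, (whitePairs idx u v).2} : Set _) := by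
      rw [key]
      exact Set.mem_insert _ _
    exact ⟨u, v, h, this⟩

theorem IsBlue.fst_eq {x y : V × ZMod 6} (h : IsBlue s(x, y)) : x.1 = y.1 := by
  obtain ⟨v, i, h⟩ := h
  rcases Sym2.eq_iff.1 h with ⟨rfl, rfl⟩ | ⟨rfl, rfl⟩ <;> rfl

theorem IsBlue.hexagonGraph_adj {x y : V × ZMod 6} (h : IsBlue s(x, y)) :
    (hexagonGraph G idx).Adj x y := by
  obtain ⟨v, i, h⟩ := h
  rw [← mem_edgeSet, h, mem_edgeSet, hexagonGraph, fromRel_adj]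
  exact ⟨fun h => ne_add_one i (congrArg Prod.snd h), .inl (.inl ⟨rfl, .inl rfl⟩)⟩

theorem IsBlue.not_isWhite {e : Sym2 (V × ZMod 6)} (h : IsBlue e) : ¬ IsWhite G idx e := by
  rw [isWhite_iff]
  rintro ⟨d, rfl⟩
  exact d.adj.ne h.fst_eq

theorem isBlue_inVert_outVert (hidx : GoodIdx G idx) {d d' : G.Dart} (h : d'.fst = d.snd)
    (hne : d' ≠ d.symm) : IsBlue s(inVert idx d, outVert idx d') := by
  obtain ⟨⟨u, v⟩, huv⟩ := d
  obtain ⟨⟨v', w⟩, hvw⟩ := d'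
  obtain rfl : v' = v := h
  have huw : u ≠ w := by
    rintro rfl
    exact hne rfl
  rcases evenRep_consecutive _ _ (hidx.1 _ _ huv.symm) (hidx.1 _ _ hvw)
    (hidx.2 _ _ _ huv.symm hvw huw) with h | h
  · exact ⟨v', evenRep (idx v' u) + 3, by simp [inVert, outVert, h]⟩
  · exact ⟨v', evenRep (idx v' w), by simp [inVert, outVert, h, Sym2.eq_swap]⟩

theorem exists_outVert_of_isBlue (hG : IsCubic G) (hidx : GoodIdx G idx) {d : G.Dart}
    {y : V × ZMod 6} (h : IsBlue s(inVert idx d, y)) :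
    ∃ d' : G.Dart, y = outVert idx d' ∧ d'.fst = d.snd := by
  obtain ⟨d', rfl | rfl⟩ := exists_dart_eq hG hidx y
  · exact ⟨d', rfl, h.fst_eq.symm⟩
  · obtain ⟨v, i, h⟩ := h
    exfalso
    rcases Sym2.eq_iff.1 h with ⟨h1, h2⟩ | ⟨h1, h2⟩ <;>
      exact evenRep_add_three_add_one_ne _ _
        (((congrArg (· + 1) (congrArg Prod.snd ‹_ = (v, i)›)).trans
          (congrArg Prod.snd ‹_ = (v, i + 1)›).symm))

theorem IsBluePM.sdGraph_adj {M : (hexagonGraph G idx).Subgraph} (hM : IsBluePM G idx M)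
    {x y : V × ZMod 6} : (sdGraph G idx M).Adj x y ↔
      M.Adj x y ∨ ∃ d : G.Dart, s(x, y) = s(outVert idx d, inVert idx d) := by
  have hdisj : Disjoint M.edgeSet {e | IsWhite G idx e} :=
    Set.disjoint_left.2 fun e he => (hM.2 e he).not_isWhite
  rw [sdGraph, fromEdgeSet_adj, show symmDiff M.edgeSet {e | IsWhite G idx e} =
      M.edgeSet ∪ {e | IsWhite G idx e} from hdisj.symmDiff_eq_sup, Set.mem_union,
    Subgraph.mem_edgeSet, Set.mem_ofPred_eq, isWhite_iff, and_iff_left_of_imp]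
  rintro (h | ⟨d, hd⟩)
  · exact h.ne
  · rintro rfl
    rcases Sym2.eq_iff.1 hd with ⟨h1, h2⟩ | ⟨h1, h2⟩
    · exact outVert_ne_inVert d d (h1.symm.trans h2)
    · exact outVert_ne_inVert d d (h2.symm.trans h1)

/-- The blue perfect matching joining the head of each dart to the tail of its successor. -/
def successorMatching (hidx : GoodIdx G idx) {φ : Equiv.Perm G.Dart}
    (hφ : IsOneWayTraversal G φ) : (hexagonGraph G idx).Subgraph where
  verts := Set.univ
  Adj x y := ∃ d, s(x, y) = s(inVert idx d, outVert idx (φ d))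
  adj_sub := by
    rintro x y ⟨d, h⟩
    refine IsBlue.hexagonGraph_adj (h ▸ isBlue_inVert_outVert hidx (hφ.1 d) fun h => hφ.2 d ?_)
    rw [← h, Equiv.Perm.sameCycle_apply_right]
  edge_vert _ := Set.mem_univ _
  symm := ⟨fun x y ⟨d, h⟩ => ⟨d, Sym2.eq_swap.trans h⟩⟩

theorem isBluePM_successorMatching (hG : IsCubic G) (hidx : GoodIdx G idx)
    {φ : Equiv.Perm G.Dart} (hφ : IsOneWayTraversal G φ) :
    IsBluePM G idx (successorMatching hidx hφ) := by
  refine ⟨Subgraph.isPerfectMatching_iff.2 fun x => ?_, ?_⟩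
  · obtain ⟨d, rfl | rfl⟩ := exists_dart_eq hG hidx x
    · refine ⟨inVert idx (φ.symm d), ⟨φ.symm d, by simp [Sym2.eq_swap]⟩, ?_⟩
      rintro y ⟨d', h⟩
      rcases Sym2.eq_iff.1 h with ⟨h1, -⟩ | ⟨h1, rfl⟩
      · exact absurd h1 (outVert_ne_inVert _ _)
      · rw [outVert_injective hidx h1, φ.symm_apply_apply]
    · refine ⟨outVert idx (φ d), ⟨d, rfl⟩, ?_⟩
      rintro y ⟨d', h⟩
      rcases Sym2.eq_iff.1 h with ⟨h1, rfl⟩ | ⟨h1, -⟩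
      · rw [inVert_injective hidx h1]
      · exact absurd h1.symm (outVert_ne_inVert _ _)
  · intro e
    induction e with | _ x y
    rintro ⟨d, h⟩
    rw [h]
    refine isBlue_inVert_outVert hidx (hφ.1 d) fun h => hφ.2 d ?_
    rw [← h, Equiv.Perm.sameCycle_apply_right]

theorem safePM_successorMatching (hG : IsCubic G) (hidx : GoodIdx G idx)
    {φ : Equiv.Perm G.Dart} (hφ : IsOneWayTraversal G φ) :
    SafePM G idx (successorMatching hidx hφ) := by
  choose f hf using exists_dart_eq hG hidx
  have hout : ∀ d, f (outVert idx d) = d := fun d =>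
    ((hf (outVert idx d)).resolve_right (outVert_ne_inVert _ _)
      |> outVert_injective hidx).symm
  have hin : ∀ d, f (inVert idx d) = d := fun d =>
    ((hf (inVert idx d)).resolve_left (outVert_ne_inVert _ _).symm
      |> inVert_injective hidx).symm
  have hadj : ∀ x y, (sdGraph G idx (successorMatching hidx hφ)).Adj x y →
      φ.SameCycle (f x) (f y) := by
    intro x y h
    rcases (isBluePM_successorMatching hG hidx hφ).sdGraph_adj.1 h with ⟨d, h⟩ | ⟨d, h⟩ <;>
      rcases Sym2.eq_iff.1 h with ⟨rfl, rfl⟩ | ⟨rfl, rfl⟩ <;>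
      simp [hout, hin, Equiv.Perm.SameCycle.rfl]
  have hreach : ∀ x y, (sdGraph G idx (successorMatching hidx hφ)).Reachable x y →
      φ.SameCycle (f x) (f y) := by
    rintro x y ⟨p⟩
    induction p with
    | nil => exact .rfl
    | cons h p ih => exact (hadj _ _ h).trans ih
  intro v i hr
  have hs := hreach _ _ hr
  obtain ⟨d, h | h⟩ := exists_dart_eq hG hidx (v, i)
  · have h' : (v, i + 3) = inVert idx d.symm := by
      simp only [outVert, Prod.mk.injEq] at h
      exact Prod.ext h.1 (congrArg (· + 3) h.2)
    rw [h, h', hout, hin] at hs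
    exact hφ.2 d hs
  · have h' : (v, i + 3) = outVert idx d.symm := by
      simp only [inVert, Prod.mk.injEq] at h
      exact Prod.ext h.1 ((congrArg (· + 3) h.2).trans (add_three_add_three _))
    rw [h, h', hout, hin] at hs
    exact hφ.2 d hs

theorem exists_isOneWayTraversal [Finite V] (hG : IsCubic G) (hidx : GoodIdx G idx)
    {M : (hexagonGraph G idx).Subgraph} (hM : IsBluePM G idx M) (hsafe : SafePM G idx M) :
    ∃ φ, IsOneWayTraversal G φ := by
  have : Finite G.Dart := Finite.of_injective (fun d => d.toProd) fun _ _ h => Dart.ext _ _ h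
  have huniq := Subgraph.isPerfectMatching_iff.1 hM.1
  have hnext : ∀ d : G.Dart, ∃ d' : G.Dart,
      M.Adj (inVert idx d) (outVert idx d') ∧ d'.fst = d.snd := by
    intro d
    obtain ⟨y, hy, -⟩ := huniq (inVert idx d)
    obtain ⟨d', rfl, h⟩ := exists_outVert_of_isBlue hG hidx (hM.2 s(_, _) hy)
    exact ⟨d', hy, h⟩
  choose n hn hfst using hnext
  have hinj : Function.Injective n := fun d d' h =>
    inVert_injective hidx ((huniq (outVert idx (n d))).unique (hn d).symm (h ▸ (hn d').symm))
  let φ := Equiv.ofBijective n (Finite.injective_iff_bijective.1 hinj)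
  refine ⟨φ, hfst, fun d hs => hsafe d.fst (evenRep (idx d.fst d.snd)) ?_⟩
  have hwhite : ∀ d : G.Dart, (sdGraph G idx M).Reachable (outVert idx d) (inVert idx d) :=
    fun d => (hM.sdGraph_adj.2 (.inr ⟨d, rfl⟩)).reachable
  have hstep : ∀ d, (sdGraph G idx M).connectedComponentMk (outVert idx (φ d)) =
      (sdGraph G idx M).connectedComponentMk (outVert idx d) := fun d =>
    (ConnectedComponent.eq.2
      ((hwhite d).trans (hM.sdGraph_adj.2 (.inl (hn d))).reachable)).symm
  exact (ConnectedComponent.eq.1 (eq_of_sameCycle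
    (f := fun d => (sdGraph G idx M).connectedComponentMk (outVert idx d)) hstep hs)).trans
      (hwhite d.symm)

end Hexagons

/-- a finite simple cubic graph has a directed cycle double cover iff its
hexagon graph admits a safe blue perfect matching. -/
theorem stmt8 {V : Type} [Fintype V] [DecidableEq V] (G : SimpleGraph V)
    (hG : IsCubic G) (idx : V → V → ZMod 6) (hidx : GoodIdx G idx) :
    HasDCDC G ↔
      ∃ M : (hexagonGraph G idx).Subgraph, IsBluePM G idx M ∧ SafePM G idx M := by
  rw [hasDCDC_iff hG]
  constructor
  · rintro ⟨φ, hφ⟩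
    exact ⟨successorMatching hidx hφ, isBluePM_successorMatching hG hidx hφ,
      safePM_successorMatching hG hidx hφ⟩
  · rintro ⟨M, hM, hsafe⟩
    exact exists_isOneWayTraversal hG hidx hM hsafe

end Hex
end

section
/- Let G be a finite simple cubic graph, H a hexagon graph of G, W the set of white edges of H, and R the set of red edges of H. Then every connected component of the spanning subgraph of H with edge set W ∪ R is a cycle on four vertices. -/
open SimpleGraph

namespace Hex

variable {V : Type}

/-- A cycle that is an induced subgraph closed under adjacency is a whole connected component. -/
lemma nonempty_induce_supp_iso_cycleGraph {W : Type*} {K : SimpleGraph W} {n : ℕ} [NeZero n]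
    (hn : (cycleGraph n).Connected) (f : cycleGraph n ↪g K)
    (hf : ∀ k q, K.Adj (f k) q → q ∈ Set.range f) :
    Nonempty ((K.induce (K.connectedComponentMk (f 0)).supp) ≃g cycleGraph n) := by
  have hrange : ∀ q, q ∈ (K.connectedComponentMk (f 0)).supp ↔ q ∈ Set.range f := by
    intro q
    rw [ConnectedComponent.mem_supp_iff, ConnectedComponent.eq]
    constructor
    · rintro hq
      have key : ∀ x y, K.Walk x y → x ∈ Set.range f → y ∈ Set.range f := by
        intro x y p
        induction p with
        | nil => exact id
        | cons h _ ih =>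
          rintro ⟨k, rfl⟩
          exact ih (hf k _ h)
      obtain ⟨p⟩ := hq.symm
      exact key _ _ p ⟨0, rfl⟩
    · rintro ⟨k, rfl⟩
      exact (hn.preconnected k 0).map f.toHom
  let g : Fin n → (K.connectedComponentMk (f 0)).supp := fun k => ⟨f k, (hrange _).2 ⟨k, rfl⟩⟩
  have hg : Function.Bijective g := by
    refine ⟨fun k l h => f.injective (congrArg Subtype.val h), fun ⟨q, hq⟩ => ?_⟩
    obtain ⟨k, rfl⟩ := (hrange q).1 hq
    exact ⟨k, rfl⟩
  exact ⟨(RelIso.mk (Equiv.ofBijective g hg) (fun {k l} => f.map_adj_iff) :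
    cycleGraph n ≃g K.induce (K.connectedComponentMk (f 0)).supp).symm⟩

/-- White edges join the vertices of opposite classes among the four vertices associated with
an edge of `G`. -/
lemma isWhite_iff_s10 (G : SimpleGraph V) (idx : V → V → ZMod 6) (v w : V) (i j : ZMod 6) :
    IsWhite G idx s((v, i), (w, j)) ↔ G.Adj v w ∧ (i = idx v w ∨ i = idx v w + 3) ∧
      (j = idx w v ∨ j = idx w v + 3) ∧ i.val % 2 ≠ j.val % 2 := by
  have parity : ∀ a : ZMod 6, (a + 3).val % 2 = 1 - a.val % 2 := by decide
  constructor
  · rintro ⟨x, y, hxy, h⟩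
    have hx := parity (idx x y)
    have hy := parity (idx y x)
    unfold whitePairs at h
    split_ifs at h with hp <;>
    · simp only [Sym2.eq_iff, Prod.mk.injEq] at h
      rcases h with (⟨⟨rfl, rfl⟩, rfl, rfl⟩ | ⟨⟨rfl, rfl⟩, rfl, rfl⟩) |
        (⟨⟨rfl, rfl⟩, rfl, rfl⟩ | ⟨⟨rfl, rfl⟩, rfl, rfl⟩) <;>
      simp only [hxy, hxy.symm, true_and, true_or, or_true] <;> omega
  · rintro ⟨h, hi, hj, hp⟩
    have hx := parity (idx v w)
    have hy := parity (idx w v)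
    refine ⟨v, w, h, ?_⟩
    unfold whitePairs
    rcases hi with rfl | rfl <;> rcases hj with rfl | rfl <;> split_ifs <;>
      first | (left; rfl) | (right; rfl) | omega

lemma white_red_adj_iff (G : SimpleGraph V) (idx : V → V → ZMod 6) (v w : V) (i j : ZMod 6) :
    (fromEdgeSet ({e | IsWhite G idx e} ∪ {e | IsRed e})).Adj (v, i) (w, j) ↔
      (v = w ∧ j = i + 3) ∨ G.Adj v w ∧ (i = idx v w ∨ i = idx v w + 3) ∧
        (j = idx w v ∨ j = idx w v + 3) ∧ i.val % 2 ≠ j.val % 2 := by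
  have invol : ∀ a : ZMod 6, a + 3 + 3 = a := by decide
  have ne : ∀ a : ZMod 6, a ≠ a + 3 := by decide
  rw [fromEdgeSet_adj, Set.mem_union, Set.mem_ofPred_eq, Set.mem_ofPred_eq, isWhite_iff_s10]
  constructor
  · rintro ⟨h | ⟨x, k, h⟩, -⟩
    · exact Or.inr h
    · simp only [Sym2.eq_iff, Prod.mk.injEq] at h
      rcases h with ⟨⟨rfl, rfl⟩, rfl, rfl⟩ | ⟨⟨rfl, rfl⟩, rfl, rfl⟩
      · exact Or.inl ⟨rfl, rfl⟩
      · exact Or.inl ⟨rfl, (invol _).symm⟩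
  · rintro (⟨rfl, rfl⟩ | h)
    · exact ⟨Or.inr ⟨v, i, rfl⟩, fun h => ne i (congrArg Prod.snd h)⟩
    · exact ⟨Or.inl h, fun e => h.1.ne (congrArg Prod.fst e)⟩

/-- In a cubic graph, each of the indices `0, 1, 2` is used at each vertex. -/
lemma exists_adj_idx_eq {G : SimpleGraph V} (hG : IsCubic G) {idx : V → V → ZMod 6}
    (hidx : GoodIdx G idx) (v : V) {r : ZMod 6} (hr : r.val < 3) :
    ∃ u, G.Adj v u ∧ idx v u = r := by
  have hinj : Set.InjOn (idx v) (G.neighborSet v) := fun x hx y hy hxy =>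
    by_contra fun hne => hidx.2 v x y hx hy hne hxy
  have hsub : idx v '' G.neighborSet v ⊆ ((Finset.univ.filter fun a : ZMod 6 => a.val < 3) :
      Finset (ZMod 6)) := by
    rintro _ ⟨u, hu, rfl⟩
    simpa using hidx.1 v u hu
  have heq := Set.eq_of_subset_of_ncard_le hsub (by
    rw [hinj.ncard_image, hG v, Set.ncard_coe_finset]
    decide)
  have hmem : r ∈ idx v '' G.neighborSet v := by
    rw [heq]
    simpa using hr
  exact hmem

/-- every connected component of the spanning subgraph of the hexagon graph
with edge set `W ∪ R` is a cycle on four vertices. -/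
theorem stmt10 {V : Type} [Fintype V] [DecidableEq V] (G : SimpleGraph V)
    (hG : IsCubic G) (idx : V → V → ZMod 6) (hidx : GoodIdx G idx) :
    ∀ c : (SimpleGraph.fromEdgeSet
        ({e | IsWhite G idx e} ∪ {e | IsRed e})).ConnectedComponent,
      Nonempty (((SimpleGraph.fromEdgeSet
        ({e | IsWhite G idx e} ∪ {e | IsRed e})).induce c.supp) ≃g cycleGraph 4) := by
  have cover : ∀ i : ZMod 6, ∃ r : ZMod 6, r.val < 3 ∧ (i = r ∨ i = r + 3) := by decide
  have small : ∀ a b : ZMod 6, a.val < 3 → b.val < 3 → ∀ i : ZMod 6, (i = a ∨ i = a + 3) →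
      (i = b ∨ i = b + 3) → a = b := by decide
  have lift_parity : ∀ i b : ZMod 6, ∃ t : ZMod 6, (t = b ∨ t = b + 3) ∧
      i.val % 2 = t.val % 2 := by decide
  have opp : ∀ a b : ZMod 6, (a = b ∨ a = b + 3) → (a + 3 = b ∨ a + 3 = b + 3) := by decide
  have cases_opp : ∀ a b c : ZMod 6, (a = b ∨ a = b + 3) → (c = b ∨ c = b + 3) →
      (c = a ∨ c = a + 3) := by decide
  have parity : ∀ a : ZMod 6, (a + 3).val % 2 = 1 - a.val % 2 := by decide
  have invol : ∀ a : ZMod 6, a + 3 + 3 = a := by decide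
  have three_ne : (3 : ZMod 6) ≠ 0 := by decide
  have cycle_adj : ∀ k l : Fin 4, (cycleGraph 4).Adj k l ↔ k.val % 2 ≠ l.val % 2 := by
    simp only [cycleGraph_adj]
    decide
  intro c
  induction c using ConnectedComponent.ind with | _ p
  obtain ⟨v, i⟩ := p
  obtain ⟨r, hr, hir⟩ := cover i
  obtain ⟨u, huv, rfl⟩ := exists_adj_idx_eq hG hidx v hr
  obtain ⟨t, ht, hti⟩ := lift_parity i (idx u v)
  have hi' := opp _ _ hir
  have ht' := opp _ _ ht
  have hi'' : i + 3 = idx v u ∨ i = idx v u := by simpa using hi'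
  have ht'' : t + 3 = idx u v ∨ t = idx u v := by simpa using ht'
  have pi := parity i
  have pt := parity t
  let f : Fin 4 → V × ZMod 6 := ![(v, i), (v, i + 3), (u, t), (u, t + 3)]
  have hadj : ∀ k l, (fromEdgeSet ({e | IsWhite G idx e} ∪ {e | IsRed e})).Adj (f k) (f l) ↔
      (cycleGraph 4).Adj k l := by
    intro k l
    rw [cycle_adj]
    refine (white_red_adj_iff G idx (f k).1 (f l).1 (f k).2 (f l).2).trans ?_
    fin_cases k <;> fin_cases l <;>
      simp [f, huv, huv.symm, huv.ne, huv.ne.symm, hir, ht, hi'', ht'', invol,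
        three_ne] <;> omega
  have hinj : Function.Injective f := by
    intro k l
    fin_cases k <;> fin_cases l <;> simp [f, huv.ne, huv.ne.symm, three_ne]
  refine nonempty_induce_supp_iso_cycleGraph (n := 4) cycleGraph_connected
    ⟨⟨f, hinj⟩, fun {k l} => hadj k l⟩ ?_
  have neighbor : ∀ x y, G.Adj x y → ∀ s, (s = idx x y ∨ s = idx x y + 3) → ∀ w j,
      (fromEdgeSet ({e | IsWhite G idx e} ∪ {e | IsRed e})).Adj (x, s) (w, j) →
      (w = x ∧ (j = idx x y ∨ j = idx x y + 3)) ∨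
        (w = y ∧ (j = idx y x ∨ j = idx y x + 3)) := by
    intro x y hxy s hs w j h
    rw [white_red_adj_iff] at h
    rcases h with ⟨rfl, rfl⟩ | ⟨hxw, hsw, hj, -⟩
    · exact Or.inl ⟨rfl, opp _ _ hs⟩
    · have hidx_eq := small _ _ (hidx.1 x y hxy) (hidx.1 x w hxw) s hs hsw
      obtain rfl : w = y := by_contra fun hne => hidx.2 x w y hxw hxy hne hidx_eq.symm
      exact Or.inr ⟨rfl, hj⟩
  have hmem : ∀ w j, (w = v ∧ (j = idx v u ∨ j = idx v u + 3)) ∨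
      (w = u ∧ (j = idx u v ∨ j = idx u v + 3)) → (w, j) ∈ Set.range f := by
    rintro w j (⟨rfl, hj⟩ | ⟨rfl, hj⟩)
    · rcases cases_opp _ _ _ hir hj with rfl | rfl
      exacts [⟨0, rfl⟩, ⟨1, rfl⟩]
    · rcases cases_opp _ _ _ ht hj with rfl | rfl
      exacts [⟨2, rfl⟩, ⟨3, rfl⟩]
  rintro k ⟨w, j⟩ h
  apply hmem
  fin_cases k
  · exact neighbor v u huv _ hir w j h
  · exact neighbor v u huv _ hi' w j h
  · exact (neighbor u v huv.symm _ ht w j h).symm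
  · exact (neighbor u v huv.symm _ ht' w j h).symm

end Hex
end
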